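/- Let r > 0, let (Z,d) be a complete metric space that is metrically convex, let α ∈ [0,1), and let F be a map from Z to the nonempty closed bounded subsets of Z such that H(Fy, Fz) ≤ α·d(y,z) for all y, z ∈ Z with d(y,z) < r, where H denotes the Hausdorff distance. Then H(Fy, Fz) ≤ α·d(y,z) for all y, z ∈ Z. -/

import Mathlib

open Metric Set Filter

/-- A Brezis–Browder type maximality principle: a closed preorder on a complete metric space,
whose steps are dominated by the decrease of a continuous function bounded below by `0`,
has a maximal element above every point. -/
theorem exists_maximal_of_dist_le_sub {X : Type*} [MetricSpace X] [CompleteSpace X]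
    (R : X → X → Prop) (φ : X → ℝ) (hφ : Continuous φ) (hφ0 : ∀ x, 0 ≤ φ x)
    (hrefl : ∀ x, R x x) (htrans : ∀ x y z, R x y → R y z → R x z)
    (hdist : ∀ x y, R x y → dist x y ≤ φ x - φ y)
    (hlim : ∀ (a : X) (u : ℕ → X) (x : X), (∀ᶠ n in atTop, R a (u n)) →
      Tendsto u atTop (nhds x) → R a x) (a : X) :
    ∃ m, R a m ∧ ∀ w, R m w → w = m := by
  have hstep : ∀ (n : ℕ) (x : X), ∃ y, R x y ∧ ∀ w, R x w → φ y ≤ φ w + 1 / ((n : ℝ) + 1) := by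
    intro n x
    have hne : (φ '' {w | R x w}).Nonempty := ⟨φ x, x, hrefl x, rfl⟩
    have hbdd : BddBelow (φ '' {w | R x w}) := ⟨0, by rintro _ ⟨w, -, rfl⟩; exact hφ0 w⟩
    have hpos : (0 : ℝ) < 1 / ((n : ℝ) + 1) := by positivity
    obtain ⟨_, ⟨y, hy, rfl⟩, hlt⟩ := exists_lt_of_csInf_lt hne (lt_add_of_pos_right _ hpos)
    refine ⟨y, hy, fun w hw => ?_⟩
    have := csInf_le hbdd ⟨w, hw, rfl⟩
    linarith
  choose f hfR hfφ using hstep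
  let u : ℕ → X := fun n => Nat.rec a (fun k x => f k x) n
  have hu : ∀ n, u (n + 1) = f n (u n) := fun n => rfl
  have hmono : ∀ n m, n ≤ m → R (u n) (u m) := by
    intro n m hnm
    induction m, hnm using Nat.le_induction with
    | base => exact hrefl _
    | succ k _ ih => exact htrans _ _ _ ih (hu k ▸ hfR k (u k))
  have hanti : Antitone (fun n => φ (u n)) := fun n m hnm => by
    have h1 := hdist _ _ (hmono n m hnm)
    have h2 := dist_nonneg (x := u n) (y := u m)
    change φ (u m) ≤ φ (u n)
    linarith
  have hbdd : BddBelow (range fun n => φ (u n)) := ⟨0, by rintro _ ⟨n, rfl⟩; exact hφ0 _⟩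
  have hL := tendsto_atTop_ciInf hanti hbdd
  have hcauchy : CauchySeq u := by
    refine cauchySeq_of_le_tendsto_0' (fun n => φ (u n) - ⨅ k, φ (u k)) (fun n m hnm => ?_) ?_
    · have h1 := hdist _ _ (hmono n m hnm)
      have h2 : (⨅ k, φ (u k)) ≤ φ (u m) := ciInf_le hbdd m
      linarith
    · simpa using hL.sub_const (⨅ k, φ (u k))
  obtain ⟨x, hx⟩ := cauchySeq_tendsto_of_complete hcauchy
  have hux : ∀ n, R (u n) x := fun n =>
    hlim _ u x ((eventually_ge_atTop n).mono fun m hm => hmono n m hm) hx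
  refine ⟨x, hux 0, fun w hw => ?_⟩
  have hle : φ x ≤ φ w := by
    have h1 : Tendsto (fun n => φ (u (n + 1))) atTop (nhds (φ x)) :=
      ((hφ.tendsto x).comp hx).comp (tendsto_add_atTop_nat 1)
    have h2 : Tendsto (fun n : ℕ => φ w + 1 / ((n : ℝ) + 1)) atTop (nhds (φ w)) := by
      simpa using tendsto_one_div_add_atTop_nhds_zero_nat.const_add (φ w)
    refine le_of_tendsto_of_tendsto' h1 h2 fun n => ?_
    rw [hu]
    exact hfφ n (u n) w (htrans _ _ _ (hux n) hw)
  have h1 := hdist _ _ hw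
  have h2 : dist x w ≤ 0 := by linarith
  exact (dist_le_zero.1 h2).symm

/-- In a complete metrically convex space there are points between two distinct points that are
arbitrarily close to, but different from, the first one. -/
theorem exists_between_dist_lt {Z : Type*} [MetricSpace Z] [CompleteSpace Z]
    (hconv : ∀ u v : Z, u ≠ v → ∃ w : Z, w ≠ u ∧ w ≠ v ∧ dist u v = dist u w + dist w v)
    {r : ℝ} (hr : 0 < r) {m z : Z} (hmz : m ≠ z) :
    ∃ w, w ≠ m ∧ dist m w < r ∧ dist m w + dist w z = dist m z := by
  by_cases hz : dist m z < r
  · exact ⟨z, hmz.symm, hz, by simp⟩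
  obtain ⟨p, ⟨hp, hpr⟩, hmax⟩ := exists_maximal_of_dist_le_sub
    (fun x y : Z => dist m y + dist y x = dist m x ∧ (r ≤ dist m x → r ≤ dist m y))
    (fun x => dist m x) (by fun_prop) (fun _ => dist_nonneg) (fun x => by simp)
    (fun x y w hxy hyw => ⟨by
      linarith [hxy.1, hyw.1, dist_triangle w y x, dist_triangle m w x], hyw.2 ∘ hxy.2⟩)
    (fun x y hxy => by
      have := hxy.1
      rw [dist_comm x y]
      linarith)
    (fun a u x hu hx => by
      have hm : Tendsto (fun n => dist m (u n)) atTop (nhds (dist m x)) :=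
        tendsto_const_nhds.dist hx
      refine ⟨tendsto_nhds_unique_of_eventuallyEq (hm.add (hx.dist tendsto_const_nhds))
        tendsto_const_nhds (hu.mono fun n hn => hn.1), fun ha => ?_⟩
      exact ge_of_tendsto hm (hu.mono fun n hn => hn.2 ha)) z
  have hpr' : r ≤ dist m p := hpr (not_lt.1 hz)
  have hmp : m ≠ p := dist_pos.1 (hr.trans_le hpr')
  obtain ⟨w, hwm, hwp, hw⟩ := hconv m p hmp
  refine ⟨w, hwm, ?_, ?_⟩
  · by_contra hcon
    exact hwp (hmax w ⟨hw.symm, fun _ => not_lt.1 hcon⟩)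
  · linarith [dist_triangle w p z, dist_triangle m w z]

/-- On a complete, metrically convex metric space, every Nadler uniformly local
contraction is a global Nadler contraction: if `H(Fy, Fz) ≤ α · d(y,z)`
whenever `d(y,z) < r`, then `H(Fy, Fz) ≤ α · d(y,z)` for all `y, z`. -/
theorem nadler_local_is_global_of_metrically_convex
    {Z : Type*} [MetricSpace Z] [CompleteSpace Z]
    (hconv : ∀ u v : Z, u ≠ v → ∃ w : Z, w ≠ u ∧ w ≠ v ∧
      dist u v = dist u w + dist w v)
    (r : ℝ) (hr : 0 < r)
    (α : ℝ) (hα : 0 ≤ α) (hα1 : α < 1)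
    (F : Z → Set Z)
    (hFne : ∀ z, (F z).Nonempty)
    (hFcl : ∀ z, IsClosed (F z))
    (hFbd : ∀ z, Bornology.IsBounded (F z))
    (hcontr : ∀ y z : Z, dist y z < r →
      hausdorffDist (F y) (F z) ≤ α * dist y z) :
    ∀ y z : Z, hausdorffDist (F y) (F z) ≤ α * dist y z := by
  have htri : ∀ a b c : Z, hausdorffDist (F a) (F c) ≤
      hausdorffDist (F a) (F b) + hausdorffDist (F b) (F c) := fun a b c =>
    hausdorffDist_triangle
      (hausdorffEDist_ne_top_of_nonempty_of_bounded (hFne a) (hFne b) (hFbd a) (hFbd b))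
  intro y z
  obtain ⟨m, ⟨-, hym⟩, hmax⟩ := exists_maximal_of_dist_le_sub
    (fun a b : Z => dist a b + dist b z = dist a z ∧
      hausdorffDist (F a) (F b) ≤ α * dist a b)
    (fun x => dist x z) (by fun_prop) (fun _ => dist_nonneg) (fun x => by simp)
    (fun a b c hab hbc => by
      have h1 : dist a c = dist a b + dist b c := by
        linarith [hab.1, hbc.1, dist_triangle a b c, dist_triangle a c z]
      refine ⟨by linarith [hab.1, hbc.1], ?_⟩
      rw [h1, mul_add]
      exact (htri a b c).trans (add_le_add hab.2 hbc.2))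
    (fun a b hab => by linarith [hab.1])
    (fun a u x hu hx => by
      have ha : Tendsto (fun n => dist a (u n)) atTop (nhds (dist a x)) :=
        tendsto_const_nhds.dist hx
      have hx0 : Tendsto (fun n => dist (u n) x) atTop (nhds 0) :=
        tendsto_iff_dist_tendsto_zero.1 hx
      refine ⟨tendsto_nhds_unique_of_eventuallyEq (ha.add (hx.dist tendsto_const_nhds))
        tendsto_const_nhds (hu.mono fun n hn => hn.1), ?_⟩
      have hsum : Tendsto (fun n => α * dist a (u n) + α * dist (u n) x) atTop
          (nhds (α * dist a x)) := by
        simpa using (ha.const_mul α).add (hx0.const_mul α)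
      refine ge_of_tendsto hsum ?_
      filter_upwards [hu, hx0.eventually (gt_mem_nhds hr)] with n hn hnr
      exact (htri a (u n) x).trans (add_le_add hn.2 (hcontr _ _ hnr))) y
  by_cases hmz : m = z
  · exact hmz ▸ hym
  · obtain ⟨w, hwm, hwr, hw⟩ := exists_between_dist_lt hconv hr hmz
    exact absurd (hmax w ⟨hw, hcontr m w hwr⟩) hwm
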